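/- arXiv:0802.1228 — 6 statements merged into one kernel-verified Lean document; each statement's English description precedes it below -/
import Mathlib

section
/- Let r be a positive integer and a : ℕ^r → ℂ a sequence. Then for all n_1,…,n_r, k_1,…,k_r ∈ ℕ, (Δ_1^{k_1} ⋯ Δ_r^{k_r} (∇a))(n_1,…,n_r) = (Δ_1^{n_1} ⋯ Δ_r^{n_r} a)(k_1,…,k_r). -/
/-- The difference operator `Δ_i` on sequences `ℕ^r → ℂ`:
`(Δ_i a)(n) = a(n) − a(n + e_i)`. -/
def delta (r : ℕ) (i : Fin r) (a : (Fin r → ℕ) → ℂ) : (Fin r → ℕ) → ℂ :=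
  fun n => a n - a (Function.update n i (n i + 1))

/-- The composite `Δ_1^{k_1} ⋯ Δ_r^{k_r}`. -/
def deltaIter (r : ℕ) (k : Fin r → ℕ) : ((Fin r → ℕ) → ℂ) → ((Fin r → ℕ) → ℂ) :=
  (List.ofFn (fun i : Fin r => (delta r i)^[k i])).foldr (· ∘ ·) id

/-- The inversion operator `∇`: `(∇a)(n) = (Δ_1^{n_1} ⋯ Δ_r^{n_r} a)(0,…,0)`. -/
def nabla (r : ℕ) (a : (Fin r → ℕ) → ℂ) : (Fin r → ℕ) → ℂ :=
  fun n => deltaIter r n a (fun _ => 0)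

theorem delta_comm (r : ℕ) (i j : Fin r) : Function.Commute (delta r i) (delta r j) := by
  intro a
  funext n
  rcases eq_or_ne i j with rfl | h
  · rfl
  · simp only [delta, Function.update_of_ne h, Function.update_of_ne h.symm,
      Function.update_comm h]
    ring

/-- Raising one exponent in a composite of iterates along a duplicate-free list containing that
index amounts to one more application of the corresponding operator. -/
theorem foldr_delta_update_succ (r : ℕ) (k : Fin r → ℕ) (i : Fin r) {l : List (Fin r)}
    (hl : l.Nodup) (hi : i ∈ l) :
    (l.map fun j => (delta r j)^[Function.update k i (k i + 1) j]).foldr (· ∘ ·) id =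
      delta r i ∘ (l.map fun j => (delta r j)^[k j]).foldr (· ∘ ·) id := by
  induction l with
  | nil => simp at hi
  | cons j t ih =>
    obtain ⟨hj, ht⟩ := List.nodup_cons.mp hl
    simp only [List.map_cons, List.foldr_cons]
    rcases eq_or_ne i j with rfl | h
    · have : (t.map fun j => (delta r j)^[Function.update k i (k i + 1) j]) =
          t.map fun j => (delta r j)^[k j] :=
        List.map_congr_left fun m hm => by
          rw [Function.update_of_ne (ne_of_mem_of_not_mem hm hj)]
      rw [this, Function.update_self, Function.iterate_succ', Function.comp_assoc]
    · rw [ih ht ((List.mem_cons.mp hi).resolve_left h), Function.update_of_ne h.symm,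
        ← Function.comp_assoc, ← Function.comp_assoc,
        ((delta_comm r i j).iterate_right (k j)).comp_eq]

theorem deltaIter_update_succ (r : ℕ) (k : Fin r → ℕ) (i : Fin r) (a : (Fin r → ℕ) → ℂ) :
    deltaIter r (Function.update k i (k i + 1)) a = delta r i (deltaIter r k a) := by
  simp only [deltaIter, List.ofFn_eq_map]
  exact congrFun (foldr_delta_update_succ r k i (List.nodup_finRange r) (List.mem_finRange i)) a

theorem deltaIter_zero (r : ℕ) (a : (Fin r → ℕ) → ℂ) : deltaIter r (fun _ => 0) a = a := by
  have h (l : List (Fin r)) :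
      (l.map fun j => (delta r j)^[0]).foldr (· ∘ ·) id = id := by
    induction l with
    | nil => rfl
    | cons j t ih => rw [List.map_cons, List.foldr_cons, ih]; rfl
  simp only [deltaIter, List.ofFn_eq_map]
  exact congrFun (h _) a

/-- `(Δ_1^{k_1} ⋯ Δ_r^{k_r} (∇a))(n) = (Δ_1^{n_1} ⋯ Δ_r^{n_r} a)(k)`. -/
theorem stmt1 (r : ℕ) (hr : 0 < r) (a : (Fin r → ℕ) → ℂ) (n k : Fin r → ℕ) :
    deltaIter r k (nabla r a) n = deltaIter r n a k := by
  induction k using WellFoundedLT.induction generalizing n with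
  | ind k ih =>
    by_cases hk : k = fun _ => 0
    · rw [hk, deltaIter_zero]
      rfl
    · obtain ⟨i, hi⟩ := Function.ne_iff.mp hk
      obtain ⟨m, rfl⟩ : ∃ m : Fin r → ℕ, k = Function.update m i (m i + 1) :=
        ⟨Function.update k i (k i - 1), by simp [Nat.sub_add_cancel (Nat.pos_of_ne_zero hi)]⟩
      have hm : m < Function.update m i (m i + 1) := by simp
      rw [deltaIter_update_succ, delta, ih m hm, ih m hm, deltaIter_update_succ, delta,
        sub_sub_cancel]
end

section
/- Let r be a positive integer, 1 ≤ i ≤ r, and a : ℕ^r → ℂ a sequence. Define b : ℕ^r → ℂ by b(n) = n_i · a(n − e_i) when n_i ≥ 1 and b(n) = 0 when n_i = 0. Then for all n ∈ ℕ^r, (∇b)(n) = −n_i · (∇a)(n − e_i) when n_i ≥ 1, and (∇b)(n) = 0 when n_i = 0. (Equivalently, at the level of exponential generating functions, ∇ X_i = −X_i, where X_i denotes multiplication by X_i on ℂ[[X_1,…,X_r]] and the inversion of an operator ξ is defined by (∇ξ)f = ∇(ξ(∇f)).) -/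
/-- The difference operator `Δ_i` as a linear endomorphism. -/
def deltaEnd (r : ℕ) (i : Fin r) : Module.End ℂ ((Fin r → ℕ) → ℂ) where
  toFun := delta r i
  map_add' a b := by
    funext n
    simp only [delta, Pi.add_apply]
    ring
  map_smul' c a := by
    funext n
    simp only [delta, Pi.smul_apply, smul_eq_mul, RingHom.id_apply]
    ring

/-- Multiplication of the exponential generating function by `X_i`, on sequences. -/
def mulXEnd (r : ℕ) (i : Fin r) : Module.End ℂ ((Fin r → ℕ) → ℂ) where
  toFun a := fun n => (n i : ℂ) * a (Function.update n i (n i - 1))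
  map_add' a b := by
    funext n
    simp only [Pi.add_apply]
    ring
  map_smul' c a := by
    funext n
    simp only [Pi.smul_apply, smul_eq_mul, RingHom.id_apply]
    ring

theorem mulXEnd_apply (r : ℕ) (i : Fin r) (a : (Fin r → ℕ) → ℂ) (n : Fin r → ℕ) :
    mulXEnd r i a n = (n i : ℂ) * a (Function.update n i (n i - 1)) := rfl

theorem deltaEnd_apply (r : ℕ) (i : Fin r) (a : (Fin r → ℕ) → ℂ) (n : Fin r → ℕ) :
    deltaEnd r i a n = a n - a (Function.update n i (n i + 1)) := rfl

theorem deltaEnd_mul_mulXEnd_self (r : ℕ) (i : Fin r) :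
    deltaEnd r i * mulXEnd r i = mulXEnd r i * deltaEnd r i - 1 := by
  refine LinearMap.ext fun a => funext fun n => ?_
  simp only [Module.End.mul_apply, LinearMap.sub_apply, Module.End.one_apply, Pi.sub_apply,
    deltaEnd_apply, mulXEnd_apply, Function.update_self, Function.update_idem,
    Nat.add_sub_cancel, Function.update_eq_self]
  rcases Nat.eq_zero_or_pos (n i) with h | h
  · simp [h]
  · rw [Nat.sub_add_cancel h, Function.update_eq_self]
    push_cast
    ring

theorem deltaEnd_commute_mulXEnd (r : ℕ) {i j : Fin r} (hij : j ≠ i) :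
    Commute (deltaEnd r j) (mulXEnd r i) := by
  refine LinearMap.ext fun a => funext fun n => ?_
  simp only [Module.End.mul_apply, deltaEnd_apply, mulXEnd_apply,
    Function.update_of_ne hij, Function.update_of_ne hij.symm,
    Function.update_comm hij]
  ring

/-- If `D M = M D - 1` in a ring, then `D ^ k M = M D ^ k - k D ^ (k - 1)`. -/
theorem pow_mul_eq_of_mul_eq_sub_one {R : Type*} [Ring R] {D M : R} (h : D * M = M * D - 1)
    (k : ℕ) : D ^ k * M = M * D ^ k - k • D ^ (k - 1) := by
  induction k with
  | zero => simp
  | succ k ih =>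
    have hk : k • (D * D ^ (k - 1)) = k • D ^ k := by
      cases k with
      | zero => simp
      | succ k => rw [Nat.add_sub_cancel, pow_succ' D k]
    rw [pow_succ', mul_assoc, ih, mul_sub, ← mul_assoc, h, mul_smul_comm, hk, sub_mul, one_mul,
      mul_assoc, Nat.add_sub_cancel, add_smul, one_smul]
    abel

theorem prod_deltaEnd_commute_mulXEnd (r : ℕ) (i : Fin r) (k : Fin r → ℕ) (l : List (Fin r))
    (hl : i ∉ l) : Commute (l.map fun j => deltaEnd r j ^ k j).prod (mulXEnd r i) := by
  refine Commute.list_prod_left _ _ fun x hx => ?_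
  obtain ⟨j, hj, rfl⟩ := List.mem_map.1 hx
  exact (deltaEnd_commute_mulXEnd r (ne_of_mem_of_not_mem hj hl)).pow_left _

theorem prod_deltaEnd_mul_mulXEnd (r : ℕ) (i : Fin r) (k : Fin r → ℕ) (l : List (Fin r))
    (hn : l.Nodup) (hl : i ∈ l) :
    (l.map fun j => deltaEnd r j ^ k j).prod * mulXEnd r i =
      mulXEnd r i * (l.map fun j => deltaEnd r j ^ k j).prod -
        k i • (l.map fun j => deltaEnd r j ^ Function.update k i (k i - 1) j).prod := by
  induction l with
  | nil => simp at hl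
  | cons j l ih =>
    obtain ⟨hj, hn⟩ := List.nodup_cons.1 hn
    simp only [List.map_cons, List.prod_cons]
    by_cases hji : j = i
    · subst hji
      have hmap : (l.map fun m => deltaEnd r m ^ Function.update k j (k j - 1) m) =
          l.map fun m => deltaEnd r m ^ k m :=
        List.map_congr_left fun m hm => by
          rw [Function.update_of_ne (ne_of_mem_of_not_mem hm hj)]
      rw [hmap, Function.update_self, mul_assoc, (prod_deltaEnd_commute_mulXEnd r j k l hj).eq,
        ← mul_assoc, pow_mul_eq_of_mul_eq_sub_one (deltaEnd_mul_mulXEnd_self r j), sub_mul,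
        smul_mul_assoc, mul_assoc]
    · have hil : i ∈ l := (List.mem_cons.1 hl).resolve_left (Ne.symm hji)
      rw [mul_assoc, ih hn hil, mul_sub, ← mul_assoc,
        ((deltaEnd_commute_mulXEnd r hji).pow_left (k j)).eq, mul_smul_comm,
        Function.update_of_ne hji, mul_assoc]

theorem deltaIter_eq_prod (r : ℕ) (k : Fin r → ℕ) (a : (Fin r → ℕ) → ℂ) :
    deltaIter r k a = ((List.finRange r).map fun j => deltaEnd r j ^ k j).prod a := by
  rw [deltaIter, List.ofFn_eq_map]
  induction List.finRange r with
  | nil => rfl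
  | cons j l ih =>
    rw [List.map_cons, List.map_cons, List.prod_cons, Module.End.mul_apply, ← ih,
      Module.End.pow_apply]
    rfl

/-- if `b(n) = n_i · a(n − e_i)` (and `b(n) = 0` when `n_i = 0`), then
`(∇b)(n) = −n_i · (∇a)(n − e_i)` (and `(∇b)(n) = 0` when `n_i = 0`).
This is the sequence-level form of `∇ X_i = −X_i`. -/
theorem stmt5 (r : ℕ) (hr : 0 < r) (i : Fin r) (a b : (Fin r → ℕ) → ℂ)
    (hb : ∀ n : Fin r → ℕ,
      b n = if n i = 0 then 0 else (n i : ℂ) * a (Function.update n i (n i - 1))) :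
    ∀ n : Fin r → ℕ,
      nabla r b n =
        if n i = 0 then 0
        else -(n i : ℂ) * nabla r a (Function.update n i (n i - 1)) := by
  intro n
  have hbM : b = mulXEnd r i a := by
    funext m
    rw [hb, mulXEnd_apply]
    split_ifs with h
    · simp [h]
    · rfl
  have key : nabla r b n = -(n i : ℂ) * nabla r a (Function.update n i (n i - 1)) := by
    simp only [nabla]
    rw [deltaIter_eq_prod, deltaIter_eq_prod, hbM, ← Module.End.mul_apply,
      prod_deltaEnd_mul_mulXEnd r i n _ (List.nodup_finRange r) (List.mem_finRange i),
      LinearMap.sub_apply, Pi.sub_apply, Module.End.mul_apply, mulXEnd_apply,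
      LinearMap.smul_apply, Pi.smul_apply, nsmul_eq_mul]
    simp
  rw [key]
  split_ifs with h
  · simp [h]
  · rfl
end

section
/- Let r be a positive integer, x_1,…,x_r, t ∈ ℂ, and a : ℕ^r → ℂ a sequence. Define (ξ_{x_1,…,x_r} a)(n) = (n_1+⋯+n_r)·a(n) − Σ_{k=1}^r x_k n_k a(n − e_k) (the term for k being 0 when n_k = 0). Then ∇((ξ_{x_1,…,x_r} + t)a) = (ξ_{1−x_1,…,1−x_r} + t)(∇a). (Equivalently, the operator ξ_{x_1,…,x_r} = X_1∂_{X_1}+⋯+X_r∂_{X_r} − x_1X_1 −⋯− x_rX_r on ℂ[[X_1,…,X_r]] satisfies ∇ξ_{x_1,…,x_r} = ξ_{1−x_1,…,1−x_r}, where (∇ξ)f = ∇(ξ(∇f)).) -/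
open Finset in
/-- The operator `ξ_{x_1,…,x_r}` on sequences, corresponding to
`X_1∂_{X_1}+⋯+X_r∂_{X_r} − x_1X_1 −⋯− x_rX_r` on exponential generating functions:
`(ξ a)(n) = (n_1+⋯+n_r)·a(n) − Σ_k x_k n_k a(n − e_k)`
(the `k`-th term vanishing when `n_k = 0` because of the factor `n_k`). -/
noncomputable def xiOp (r : ℕ) (x : Fin r → ℂ) (a : (Fin r → ℕ) → ℂ) :
    (Fin r → ℕ) → ℂ :=
  fun n => (∑ k : Fin r, (n k : ℂ)) * a n
    - ∑ k : Fin r, x k * (n k : ℂ) * a (Function.update n k (n k - 1))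

/-- The operator `a ↦ (n ↦ n_k a(n − e_k))`, multiplication by `X_k` on exponential
generating functions. -/
def mulVarEnd (r : ℕ) (k : Fin r) : Module.End ℂ ((Fin r → ℕ) → ℂ) where
  toFun a := fun n => (n k : ℂ) * a (Function.update n k (n k - 1))
  map_add' a b := by
    funext n
    simp only [Pi.add_apply]
    ring
  map_smul' c a := by
    funext n
    simp only [Pi.smul_apply, smul_eq_mul, RingHom.id_apply]
    ring

/-- The composite `Δ_1^{n_1} ⋯ Δ_r^{n_r}` as a linear endomorphism. -/
def deltaPowEnd (r : ℕ) (n : Fin r → ℕ) : Module.End ℂ ((Fin r → ℕ) → ℂ) :=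
  (List.ofFn fun i => deltaEnd r i ^ n i).prod

theorem mulVarEnd_apply (r : ℕ) (k : Fin r) (a : (Fin r → ℕ) → ℂ) (n : Fin r → ℕ) :
    mulVarEnd r k a n = (n k : ℂ) * a (Function.update n k (n k - 1)) := rfl

theorem foldr_comp_eq_prod {V : Type*} [AddCommGroup V] [Module ℂ V]
    (l : List (Module.End ℂ V)) :
    (l.map (fun f : Module.End ℂ V => (f : V → V))).foldr (· ∘ ·) id = l.prod := by
  induction l with
  | nil => rfl
  | cons f l ih =>
    rw [List.map_cons, List.foldr_cons, ih, List.prod_cons]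
    rfl

theorem nabla_eq_deltaPowEnd (r : ℕ) (a : (Fin r → ℕ) → ℂ) (n : Fin r → ℕ) :
    nabla r a n = deltaPowEnd r n a 0 := by
  have h : deltaIter r n = deltaPowEnd r n := by
    rw [deltaPowEnd, ← foldr_comp_eq_prod, List.map_ofFn, deltaIter]
    congr 2
    funext i
    simp only [Function.comp_apply, Module.End.coe_pow]
    rfl
  rw [nabla, h]
  rfl

theorem deltaEnd_commute (r : ℕ) (i j : Fin r) : Commute (deltaEnd r i) (deltaEnd r j) := by
  rcases eq_or_ne i j with rfl | hij
  · exact Commute.refl _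
  · refine LinearMap.ext fun a => funext fun n => ?_
    simp only [Module.End.mul_apply, deltaEnd_apply, Function.update_of_ne hij,
      Function.update_of_ne hij.symm, Function.update_comm hij]
    ring

theorem deltaEnd_commute_mulVarEnd (r : ℕ) {j k : Fin r} (hjk : j ≠ k) :
    Commute (deltaEnd r j) (mulVarEnd r k) := by
  refine LinearMap.ext fun a => funext fun n => ?_
  simp only [Module.End.mul_apply, deltaEnd_apply, mulVarEnd_apply, Function.update_of_ne hjk,
    Function.update_of_ne hjk.symm, Function.update_comm hjk]
  ring

theorem deltaEnd_mul_mulVarEnd (r : ℕ) (k : Fin r) :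
    deltaEnd r k * mulVarEnd r k = mulVarEnd r k * deltaEnd r k - 1 := by
  refine LinearMap.ext fun a => funext fun n => ?_
  simp only [Module.End.mul_apply, deltaEnd_apply, mulVarEnd_apply, LinearMap.sub_apply,
    Module.End.one_apply, Pi.sub_apply, Function.update_self, Function.update_idem,
    Nat.add_sub_cancel, Function.update_eq_self]
  rcases Nat.eq_zero_or_pos (n k) with h | h
  · simp [h]
  · rw [Nat.sub_add_cancel h, Function.update_eq_self]
    push_cast
    ring

/-- If `D M = M D − 1`, then `D ^ m M = M D ^ m − m D ^ (m − 1)`. -/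
theorem pow_mul_of_mul_eq_sub_one {A : Type*} [Ring A] {D M : A} (h : D * M = M * D - 1)
    (m : ℕ) : D ^ m * M = M * D ^ m - (m : A) * D ^ (m - 1) := by
  induction m with
  | zero => simp
  | succ m ih =>
    have hm : (m : A) * (D * D ^ (m - 1)) = (m : A) * D ^ m := by
      cases m with
      | zero => simp
      | succ m => rw [Nat.add_sub_cancel, ← pow_succ']
    calc D ^ (m + 1) * M = D * (D ^ m * M) := by rw [pow_succ', mul_assoc]
      _ = D * M * D ^ m - (m : A) * (D * D ^ (m - 1)) := by
        rw [ih, mul_sub, ← mul_assoc, ← mul_assoc D, ← mul_assoc (m : A), Nat.cast_comm]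
      _ = M * D ^ (m + 1) - ((m + 1 : ℕ) : A) * D ^ (m + 1 - 1) := by
        rw [hm, h, Nat.add_sub_cancel, pow_succ']
        push_cast
        noncomm_ring

theorem prod_ofFn_pow_update {A : Type*} [Monoid A] {r : ℕ} (f : Fin r → A)
    (hf : ∀ i j, Commute (f i) (f j)) (n : Fin r → ℕ) (k : Fin r) (m : ℕ) :
    (List.ofFn fun i => f i ^ Function.update n k m i).prod
      = (List.ofFn fun i => f i ^ Function.update n k 0 i).prod * f k ^ m := by
  induction r with
  | zero => exact k.elim0
  | succ r ih =>
    simp only [List.ofFn_succ, List.prod_cons]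
    cases k using Fin.cases with
    | zero =>
      simp only [Function.update_self, pow_zero, one_mul,
        Function.update_of_ne (Fin.succ_ne_zero _)]
      refine Commute.list_prod_right _ _ fun y hy => ?_
      obtain ⟨i, rfl⟩ := (List.mem_ofFn' _ _).1 hy
      exact (hf _ _).pow_pow _ _
    | succ k =>
      have hu (m : ℕ) (i : Fin r) : Function.update n k.succ m i.succ
          = Function.update (fun i => n i.succ) k m i := by
        simp [Function.update_apply]
      simp only [hu, Function.update_of_ne (Fin.succ_ne_zero k).symm]
      rw [ih (fun i => f i.succ) (fun i j => hf _ _), mul_assoc]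

theorem deltaPowEnd_update (r : ℕ) (n : Fin r → ℕ) (k : Fin r) (m : ℕ) :
    deltaPowEnd r (Function.update n k m)
      = deltaPowEnd r (Function.update n k 0) * deltaEnd r k ^ m :=
  prod_ofFn_pow_update _ (deltaEnd_commute r) n k m

theorem deltaPowEnd_update_zero_commute (r : ℕ) (n : Fin r → ℕ) (k : Fin r) :
    Commute (deltaPowEnd r (Function.update n k 0)) (mulVarEnd r k) := by
  refine Commute.list_prod_left _ _ fun y hy => ?_
  obtain ⟨i, rfl⟩ := (List.mem_ofFn' _ _).1 hy
  rcases eq_or_ne i k with rfl | hik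
  · simp
  · exact (deltaEnd_commute_mulVarEnd r hik).pow_left _

theorem deltaPowEnd_mul_mulVarEnd (r : ℕ) (n : Fin r → ℕ) (k : Fin r) :
    deltaPowEnd r n * mulVarEnd r k = mulVarEnd r k * deltaPowEnd r n
      - (n k : Module.End ℂ ((Fin r → ℕ) → ℂ))
        * deltaPowEnd r (Function.update n k (n k - 1)) := by
  have h := deltaPowEnd_update r n k (n k)
  rw [Function.update_eq_self] at h
  rw [h, deltaPowEnd_update r n k (n k - 1), mul_assoc,
    pow_mul_of_mul_eq_sub_one (deltaEnd_mul_mulVarEnd r k), mul_sub, ← mul_assoc,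
    (deltaPowEnd_update_zero_commute r n k).eq, mul_assoc, ← mul_assoc _ (Nat.cast _),
    ← Nat.cast_comm, mul_assoc]

theorem nabla_mulVarEnd (r : ℕ) (k : Fin r) (a : (Fin r → ℕ) → ℂ) (n : Fin r → ℕ) :
    nabla r (mulVarEnd r k a) n
      = -((n k : ℂ) * nabla r a (Function.update n k (n k - 1))) := by
  have h := congrFun (LinearMap.congr_fun (deltaPowEnd_mul_mulVarEnd r n k) a) 0
  simp only [nabla_eq_deltaPowEnd]
  simpa [Module.End.mul_apply, mulVarEnd_apply, Module.End.natCast_apply] using h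

theorem nabla_deltaEnd (r : ℕ) (k : Fin r) (a : (Fin r → ℕ) → ℂ) (n : Fin r → ℕ) :
    nabla r (deltaEnd r k a) n = nabla r a (Function.update n k (n k + 1)) := by
  have h := deltaPowEnd_update r n k (n k)
  rw [Function.update_eq_self] at h
  rw [nabla_eq_deltaPowEnd, nabla_eq_deltaPowEnd, deltaPowEnd_update, pow_succ, ← mul_assoc,
    ← h, Module.End.mul_apply]

theorem nabla_mulVarEnd_sub_deltaEnd (r : ℕ) (k : Fin r) (a : (Fin r → ℕ) → ℂ)
    (n : Fin r → ℕ) :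
    nabla r (mulVarEnd r k (a - deltaEnd r k a)) n
      = (n k : ℂ) * nabla r a n
        - (n k : ℂ) * nabla r a (Function.update n k (n k - 1)) := by
  have hsub (m : Fin r → ℕ) : nabla r (a - deltaEnd r k a) m
      = nabla r a m - nabla r (deltaEnd r k a) m := by
    simp only [nabla_eq_deltaPowEnd, map_sub, Pi.sub_apply]
  rw [nabla_mulVarEnd, hsub, nabla_deltaEnd]
  rcases Nat.eq_zero_or_pos (n k) with h | h
  · simp [h]
  · rw [Function.update_self, Function.update_idem, Nat.sub_add_cancel h,
      Function.update_eq_self]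
    ring

theorem xiOp_add_eq_sum (r : ℕ) (x : Fin r → ℂ) (t : ℂ) (a : (Fin r → ℕ) → ℂ) :
    (fun n => xiOp r x a n + t * a n)
      = ∑ k, (mulVarEnd r k (a - deltaEnd r k a) - x k • mulVarEnd r k a) + t • a := by
  funext n
  simp only [xiOp, Pi.add_apply, Finset.sum_apply, Pi.sub_apply, Pi.smul_apply, smul_eq_mul,
    Finset.sum_sub_distrib, Finset.sum_mul]
  congr 2
  · refine Finset.sum_congr rfl fun k _ => ?_
    rw [mulVarEnd_apply, Pi.sub_apply, deltaEnd_apply]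
    rcases Nat.eq_zero_or_pos (n k) with h | h
    · simp [h]
    · rw [Function.update_self, Function.update_idem, Nat.sub_add_cancel h,
        Function.update_eq_self, sub_sub_cancel]
  · exact Finset.sum_congr rfl fun k _ => by rw [mulVarEnd_apply, mul_assoc]

/-- `∇((ξ_{x_1,…,x_r} + t) a) = (ξ_{1−x_1,…,1−x_r} + t)(∇a)`,
i.e. `∇ ξ_{x_1,…,x_r} = ξ_{1−x_1,…,1−x_r}`. -/
theorem stmt7 (r : ℕ) (hr : 0 < r) (x : Fin r → ℂ) (t : ℂ) (a : (Fin r → ℕ) → ℂ) :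
    nabla r (fun n => xiOp r x a n + t * a n)
      = fun n => xiOp r (fun k => 1 - x k) (nabla r a) n + t * nabla r a n := by
  funext n
  have hlin : nabla r (fun n => xiOp r x a n + t * a n) n
      = ∑ k, (nabla r (mulVarEnd r k (a - deltaEnd r k a)) n
          - x k * nabla r (mulVarEnd r k a) n) + t * nabla r a n := by
    rw [xiOp_add_eq_sum]
    simp only [nabla_eq_deltaPowEnd, map_add, map_sum, map_smul, Pi.add_apply,
      Finset.sum_apply, map_sub (deltaPowEnd r n), Pi.sub_apply, Pi.smul_apply, smul_eq_mul]
  rw [hlin, xiOp, Finset.sum_mul, ← Finset.sum_sub_distrib]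
  congr 1
  refine Finset.sum_congr rfl fun k _ => ?_
  rw [nabla_mulVarEnd_sub_deltaEnd, nabla_mulVarEnd]
  ring
end

section
/- Fix positive integers r and p with p ≥ 2. Let x_i = (x_{i1},…,x_{ip}) ∈ ℂ^p for 1 ≤ i ≤ r and let t_1,…,t_{p−1} ∈ ℂ ∖ {0,−1,−2,…}. For x = (x_1,…,x_p) ∈ ℂ^p write ⁻x = (x_2,…,x_p) ∈ ℂ^{p−1}. Then for all n_1,…,n_r ∈ ℕ: (n_1+⋯+n_r+t_1)·c^{t_1,…,t_{p−1}}_{x_1;⋯;x_r}(n_1,…,n_r) − Σ_{k=1}^r x_{k1} n_k · c^{t_1,…,t_{p−1}}_{x_1;⋯;x_r}(n_1,…,n_k−1,…,n_r) = c^{t_2,…,t_{p−1}}_{⁻x_1;⋯;⁻x_r}(n_1,…,n_r) (the k-th term of the sum being 0 when n_k = 0). -/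
open Finset

/-- The generalized binomial coefficient `binom(z,k) = z(z−1)⋯(z−k+1)/k!`
for `z ∈ ℂ` and `k ∈ ℕ`. -/
noncomputable def gbinom (z : ℂ) (k : ℕ) : ℂ :=
  (∏ i ∈ Finset.range k, (z - (i : ℂ))) / (Nat.factorial k : ℂ)

/-- Given the increments `ν = (ν_1,…,ν_p)` of a weakly decreasing chain
`n_1 ≥ n_2 ≥ ⋯ ≥ n_p ≥ 0` (so `ν_j = n_j − n_{j+1}` for `j < p` and `ν_p = n_p`),
`tailSum ν j = ν_j + ν_{j+1} + ⋯ + ν_p` recovers `n_j`. -/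
def tailSum {p : ℕ} (ν : Fin p → ℕ) (j : Fin p) : ℕ :=
  ∑ l : Fin p, if j ≤ l then ν l else 0

/-- The nested sum `c^{t_1,…,t_{p−1}}_{x_1;⋯;x_r}(n_1,…,n_r)`: the sum over all
chains `n_i = n_{i1} ≥ n_{i2} ≥ ⋯ ≥ n_{ip} ≥ 0` (for each `1 ≤ i ≤ r`),
parametrized by their increment vectors `ν i ∈ antidiagonalTuple p (n i)`, of
`[∏_i multinomial(n_i; ν_{i1},…,ν_{ip}) · x_{i1}^{ν_{i1}} ⋯ x_{ip}^{ν_{ip}}] /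
 [∏_{j=1}^{p−1} binom(n_{1j}+⋯+n_{rj}+t_j−1, ν_{1j}+⋯+ν_{rj}) · (n_{1j}+⋯+n_{rj}+t_j)]`. -/
noncomputable def nestedC (r p : ℕ) (x : Fin r → Fin p → ℂ) (t : Fin (p - 1) → ℂ)
    (n : Fin r → ℕ) : ℂ :=
  ∑ ν ∈ Fintype.piFinset (fun i : Fin r => Finset.Nat.antidiagonalTuple p (n i)),
    (∏ i : Fin r,
      ((Nat.multinomial Finset.univ (ν i) : ℂ) * ∏ j : Fin p, x i j ^ ν i j)) /
    (∏ j : Fin (p - 1),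
      (gbinom
          ((∑ i : Fin r,
            (tailSum (ν i) ⟨j.1, lt_of_lt_of_le j.2 (Nat.sub_le p 1)⟩ : ℕ) : ℂ)
            + t j - 1)
          (∑ i : Fin r, ν i ⟨j.1, lt_of_lt_of_le j.2 (Nat.sub_le p 1)⟩) *
        ((∑ i : Fin r,
            (tailSum (ν i) ⟨j.1, lt_of_lt_of_le j.2 (Nat.sub_le p 1)⟩ : ℕ) : ℂ)
          + t j)))

theorem gbinom_zero (z : ℂ) : gbinom z 0 = 1 := by
  simp [gbinom]

theorem succ_mul_gbinom_succ (z : ℂ) (k : ℕ) :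
    ((k : ℂ) + 1) * gbinom z (k + 1) = z * gbinom (z - 1) k := by
  have hk : (k : ℂ) + 1 ≠ 0 := by exact_mod_cast k.succ_ne_zero
  have hf : (Nat.factorial k : ℂ) ≠ 0 := by exact_mod_cast k.factorial_ne_zero
  have h : ∏ i ∈ range k, (z - ((i + 1 : ℕ) : ℂ)) = ∏ i ∈ range k, (z - 1 - (i : ℂ)) :=
    prod_congr rfl fun i _ => by push_cast; ring
  simp only [gbinom, prod_range_succ', Nat.factorial_succ, h]
  push_cast
  field_simp
  ring

theorem natCast_multinomial_cons {p : ℕ} (a : ℕ) (ρ : Fin p → ℕ) :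
    (Nat.multinomial univ (Fin.cons a ρ : Fin (p + 1) → ℕ) : ℂ) =
      ((a + ∑ j, ρ j).choose (∑ j, ρ j) : ℂ) * (Nat.multinomial univ ρ : ℂ) := by
  norm_cast
  have h₁ := Nat.multinomial_spec univ (Fin.cons a ρ : Fin (p + 1) → ℕ)
  have h₂ := Nat.multinomial_spec univ ρ
  have h₃ := Nat.add_choose_mul_factorial_mul_factorial a (∑ j, ρ j)
  simp only [Fin.prod_univ_succ, Fin.sum_univ_succ, Fin.cons_zero, Fin.cons_succ] at h₁
  have hpos : 0 < a.factorial * ∏ j, (ρ j).factorial :=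
    Nat.mul_pos a.factorial_pos (prod_pos fun j _ => (ρ j).factorial_pos)
  refine Nat.eq_of_mul_eq_mul_left hpos ?_
  rw [h₁, ← h₃, ← h₂]
  ring

theorem tailSum_zero {p : ℕ} (ν : Fin (p + 1) → ℕ) : tailSum ν 0 = ∑ j, ν j := by
  simp [tailSum]

theorem tailSum_cons_succ {p : ℕ} (a : ℕ) (ρ : Fin p → ℕ) (j : Fin p) :
    tailSum (Fin.cons a ρ : Fin (p + 1) → ℕ) j.succ = tailSum ρ j := by
  simp [tailSum, Fin.sum_univ_succ]

/-- The summand of `nestedC r (p + 1) x t n` at the increments `ν`. -/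
noncomputable def nestedTerm {r p : ℕ} (x : Fin r → Fin (p + 1) → ℂ) (t : Fin p → ℂ)
    (ν : Fin r → Fin (p + 1) → ℕ) : ℂ :=
  (∏ i, ((Nat.multinomial univ (ν i) : ℂ) * ∏ j, x i j ^ ν i j)) /
    ∏ j : Fin p,
      (gbinom ((∑ i, (tailSum (ν i) j.castSucc : ℂ)) + t j - 1) (∑ i, ν i j.castSucc) *
        ((∑ i, (tailSum (ν i) j.castSucc : ℂ)) + t j))

theorem nestedC_eq_sum_nestedTerm {r p : ℕ} (x : Fin r → Fin (p + 1) → ℂ) (t : Fin p → ℂ)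
    (n : Fin r → ℕ) :
    nestedC r (p + 1) x t n =
      ∑ ν ∈ Fintype.piFinset fun i => Nat.antidiagonalTuple (p + 1) (n i), nestedTerm x t ν :=
  rfl

/-- The weight of `m ≤ n` when the first step `n ≥ m` of the chains is split off `nestedC`. -/
noncomputable def firstStep {r : ℕ} (y : Fin r → ℂ) (s : ℂ) (n m : Fin r → ℕ) : ℂ :=
  (∏ i, (((n i).choose (m i) : ℂ) * y i ^ (n i - m i))) /
    (gbinom ((∑ i, (n i : ℂ)) + s - 1) (∑ i, (n i - m i)) * ((∑ i, (n i : ℂ)) + s))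

theorem nestedTerm_cons {r p : ℕ} (x : Fin r → Fin (p + 2) → ℂ) (t : Fin (p + 1) → ℂ)
    (n m : Fin r → ℕ) (hmn : ∀ i, m i ≤ n i) (ρ : Fin r → Fin (p + 1) → ℕ)
    (hρ : ∀ i, ∑ j, ρ i j = m i) :
    nestedTerm x t (fun i => Fin.cons (n i - m i) (ρ i)) =
      firstStep (fun i => x i 0) (t 0) n m *
        nestedTerm (fun i j => x i j.succ) (fun j => t j.succ) ρ := by
  have hn : ∀ i, n i - m i + m i = n i := fun i => Nat.sub_add_cancel (hmn i)
  have hts : ∀ i, tailSum (Fin.cons (n i - m i) (ρ i) : Fin (p + 2) → ℕ) 0 = n i := fun i => by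
    simp [tailSum_zero, Fin.sum_univ_succ (n := p + 1), hρ, hn]
  simp only [nestedTerm, firstStep, natCast_multinomial_cons, hρ, hn, Fin.prod_univ_succ (n := p),
    Fin.prod_univ_succ (n := p + 1), Fin.castSucc_zero, Fin.castSucc_succ, Fin.cons_zero,
    Fin.cons_succ, hts, tailSum_cons_succ]
  rw [div_mul_div_comm, ← prod_mul_distrib]
  congr 1
  exact prod_congr rfl fun i _ => by ring

theorem sum_piFinset_antidiagonalTuple_succ {r p : ℕ} (n : Fin r → ℕ)
    (F : (Fin r → Fin (p + 1) → ℕ) → ℂ) :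
    ∑ ν ∈ Fintype.piFinset fun i => Nat.antidiagonalTuple (p + 1) (n i), F ν =
      ∑ m ∈ Fintype.piFinset fun i => range (n i + 1),
        ∑ ρ ∈ Fintype.piFinset fun i => Nat.antidiagonalTuple p (m i),
          F fun i => Fin.cons (n i - m i) (ρ i) := by
  rw [sum_sigma']
  refine sum_bij' (fun ν _ => ⟨fun i => ∑ j, Fin.tail (ν i) j, fun i => Fin.tail (ν i)⟩)
    (fun a _ i => Fin.cons (n i - a.1 i) (a.2 i)) ?_ ?_ ?_ ?_ ?_
  · intro ν hν
    simp only [Fintype.mem_piFinset, Nat.mem_antidiagonalTuple, Fin.sum_univ_succ] at hν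
    simp only [mem_sigma, Fintype.mem_piFinset, mem_range, Nat.mem_antidiagonalTuple, Fin.tail,
      implies_true, and_true]
    exact fun i => by have := hν i; omega
  · rintro ⟨m, ρ⟩ h
    simp only [mem_sigma, Fintype.mem_piFinset, mem_range, Nat.mem_antidiagonalTuple] at h
    simp only [Fintype.mem_piFinset, Nat.mem_antidiagonalTuple, Fin.sum_univ_succ, Fin.cons_zero,
      Fin.cons_succ, h.2]
    exact fun i => by have := h.1 i; omega
  · intro ν hν
    simp only [Fintype.mem_piFinset, Nat.mem_antidiagonalTuple, Fin.sum_univ_succ] at hν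
    funext i
    have h : n i - ∑ j, Fin.tail (ν i) j = ν i 0 := by
      have := hν i
      simp only [Fin.tail]
      omega
    simp only [h, Fin.cons_self_tail]
  · rintro ⟨m, ρ⟩ h
    simp only [mem_sigma, Fintype.mem_piFinset, mem_range, Nat.mem_antidiagonalTuple] at h
    simp only [Fin.tail_cons, h.2]
  · intro ν hν
    simp only [Fintype.mem_piFinset, Nat.mem_antidiagonalTuple, Fin.sum_univ_succ] at hν
    congr 1
    funext i
    have h : n i - ∑ j, Fin.tail (ν i) j = ν i 0 := by
      have := hν i
      simp only [Fin.tail]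
      omega
    simp only [h, Fin.cons_self_tail]

theorem firstStep_eq_zero {r : ℕ} (y : Fin r → ℂ) (s : ℂ) {n m : Fin r → ℕ} {i : Fin r}
    (h : n i < m i) : firstStep y s n m = 0 := by
  rw [firstStep, prod_eq_zero (mem_univ i) (by simp [Nat.choose_eq_zero_of_lt h]), zero_div]

theorem nestedC_eq_sum_firstStep {r p : ℕ} (x : Fin r → Fin (p + 2) → ℂ) (t : Fin (p + 1) → ℂ)
    {n N : Fin r → ℕ} (hN : n ≤ N) :
    nestedC r (p + 2) x t n =
      ∑ m ∈ Fintype.piFinset fun i => range (N i + 1), firstStep (fun i => x i 0) (t 0) n m *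
        nestedC r (p + 1) (fun i j => x i j.succ) (fun j => t j.succ) m := by
  have hsub : (Fintype.piFinset fun i => range (n i + 1)) ⊆
      Fintype.piFinset fun i => range (N i + 1) :=
    Fintype.piFinset_subset _ _ fun i => range_mono (Nat.succ_le_succ (hN i))
  rw [← sum_subset hsub, nestedC_eq_sum_nestedTerm, sum_piFinset_antidiagonalTuple_succ]
  · refine sum_congr rfl fun m hm => ?_
    rw [nestedC_eq_sum_nestedTerm, mul_sum]
    simp only [Fintype.mem_piFinset, mem_range] at hm
    refine sum_congr rfl fun ρ hρ => ?_
    simp only [Fintype.mem_piFinset, Nat.mem_antidiagonalTuple] at hρ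
    exact nestedTerm_cons x t n m (fun i => Nat.lt_succ_iff.1 (hm i)) ρ hρ
  · intro m _ hm
    simp only [Fintype.mem_piFinset, mem_range, not_forall] at hm
    obtain ⟨i, hi⟩ := hm
    rw [firstStep_eq_zero _ _ (i := i) (by omega), zero_mul]

theorem mul_firstStep_update {r : ℕ} (y : Fin r → ℂ) (s : ℂ) {n m : Fin r → ℕ} (hmn : m ≤ n)
    (k : Fin r) :
    y k * (n k : ℂ) * firstStep y s (Function.update n k (n k - 1)) m =
      ((n k - m k : ℕ) : ℂ) * ((∏ i, (((n i).choose (m i) : ℂ) * y i ^ (n i - m i))) /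
        (gbinom ((∑ i, (n i : ℂ)) + s - 1 - 1) (∑ i, (n i - m i) - 1) *
          ((∑ i, (n i : ℂ)) + s - 1))) := by
  have hk : m k ≤ n k := hmn k
  rcases hk.eq_or_lt with h | h
  · rcases Nat.eq_zero_or_pos (n k) with h0 | h0
    · simp [h0]
    · rw [firstStep_eq_zero _ _ (i := k) (by simp only [Function.update_self]; omega), h]
      simp
  obtain ⟨a, ha⟩ : ∃ a, n k = a + m k + 1 := ⟨n k - m k - 1, by omega⟩
  have hprod : y k * (n k : ℂ) * ∏ i, (((Function.update n k (n k - 1) i).choose (m i) : ℂ) *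
      y i ^ (Function.update n k (n k - 1) i - m i)) =
      ((n k - m k : ℕ) : ℂ) * ∏ i, (((n i).choose (m i) : ℂ) * y i ^ (n i - m i)) := by
    rw [← mul_prod_erase univ _ (mem_univ k), ← mul_prod_erase univ (fun i =>
      ((n i).choose (m i) : ℂ) * y i ^ (n i - m i)) (mem_univ k), ← mul_assoc (y k * _),
      ← mul_assoc ((n k - m k : ℕ) : ℂ)]
    congr 1
    · have e₁ : a + m k + 1 - m k = a + 1 := by omega
      have e₂ : a + m k - m k = a := by omega
      have hc : ((a + m k + 1 : ℕ) : ℂ) * ((a + m k).choose (m k) : ℂ) =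
          ((a + m k + 1).choose (m k) : ℂ) * ((a + 1 : ℕ) : ℂ) := by
        have := Nat.add_one_mul_choose_eq (a + m k) a
        have h₁ := Nat.choose_symm_add (a := a) (b := m k)
        have h₂ := Nat.choose_symm_of_eq_add (show a + m k + 1 = (a + 1) + m k by omega)
        simp only [h₁, h₂] at this
        exact_mod_cast this
      simp only [Function.update_self, ha, Nat.add_sub_cancel, e₁, e₂]
      rw [pow_succ]
      push_cast at hc ⊢
      linear_combination (y k * y k ^ a) * hc
    · refine prod_congr rfl fun i hi => ?_
      rw [Function.update_of_ne (ne_of_mem_erase hi)]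
  have hsum : ∑ i, (Function.update n k (n k - 1) i : ℂ) = (∑ i, (n i : ℂ)) - 1 := by
    rw [← add_sum_erase univ _ (mem_univ k),
      ← add_sum_erase univ (fun i => (n i : ℂ)) (mem_univ k),
      sum_congr rfl fun i hi => by rw [Function.update_of_ne (ne_of_mem_erase hi)]]
    simp only [Function.update_self, ha, Nat.add_sub_cancel]
    push_cast
    ring
  have hsub : ∑ i, (Function.update n k (n k - 1) i - m i) = ∑ i, (n i - m i) - 1 := by
    rw [← add_sum_erase univ _ (mem_univ k),
      ← add_sum_erase univ (fun i => n i - m i) (mem_univ k),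
      sum_congr rfl fun i hi => by rw [Function.update_of_ne (ne_of_mem_erase hi)]]
    simp only [Function.update_self]
    omega
  rw [firstStep, hsum, hsub, ← mul_div_assoc, hprod, mul_div_assoc,
    show (∑ i, (n i : ℂ)) - 1 + s = (∑ i, (n i : ℂ)) + s - 1 by ring]

theorem firstStep_recurrence {r : ℕ} (y : Fin r → ℂ) (s : ℂ) {n m : Fin r → ℕ} (hmn : m ≤ n)
    (hs : (∑ i, (n i : ℂ)) + s ≠ 0) :
    ((∑ i, (n i : ℂ)) + s) * firstStep y s n m -
        ∑ k, y k * (n k : ℂ) * firstStep y s (Function.update n k (n k - 1)) m =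
      if m = n then 1 else 0 := by
  simp only [mul_firstStep_update y s hmn, ← sum_mul, ← Nat.cast_sum univ fun k => n k - m k]
  split_ifs with h
  · subst h
    simp [firstStep, gbinom_zero, mul_inv_cancel₀ hs]
  · obtain ⟨M, hM⟩ : ∃ M, ∑ i, (n i - m i) = M + 1 := by
      refine Nat.exists_eq_succ_of_ne_zero fun h0 => h ?_
      funext i
      have := (sum_eq_zero_iff.1 h0) i (mem_univ i)
      have : m i ≤ n i := hmn i
      omega
    have hk : (M : ℂ) + 1 ≠ 0 := by exact_mod_cast M.succ_ne_zero
    have hg := succ_mul_gbinom_succ ((∑ i, (n i : ℂ)) + s - 1) M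
    rw [firstStep, hM, Nat.add_sub_cancel, mul_comm (gbinom (_ - 1 - 1) M), ← hg,
      ← mul_div_assoc, mul_comm (gbinom _ _), mul_div_mul_left _ _ hs, ← mul_div_assoc,
      Nat.cast_add_one, mul_div_mul_left _ _ hk, sub_self]

theorem nestedC_recurrence {r q : ℕ} (x : Fin r → Fin (q + 2) → ℂ) (t : Fin (q + 1) → ℂ)
    (ht : ∀ m : ℕ, t 0 ≠ -(m : ℂ)) (n : Fin r → ℕ) :
    ((∑ k, (n k : ℂ)) + t 0) * nestedC r (q + 2) x t n -
        ∑ k, x k 0 * (n k : ℂ) * nestedC r (q + 2) x t (Function.update n k (n k - 1)) =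
      nestedC r (q + 1) (fun i j => x i j.succ) (fun j => t j.succ) n := by
  have hs : (∑ i, (n i : ℂ)) + t 0 ≠ 0 := fun h =>
    ht (∑ i, n i) (by push_cast; linear_combination h)
  have hupd : ∀ k, Function.update n k (n k - 1) ≤ n := fun k =>
    update_le_self_iff.2 (Nat.sub_le _ _)
  rw [nestedC_eq_sum_firstStep x t le_rfl]
  simp only [fun k => nestedC_eq_sum_firstStep x t (hupd k), mul_sum]
  rw [sum_comm, ← sum_sub_distrib]
  calc
    _ = ∑ m ∈ Fintype.piFinset fun i => range (n i + 1), (if m = n then 1 else 0) *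
        nestedC r (q + 1) (fun i j => x i j.succ) (fun j => t j.succ) m := by
      refine sum_congr rfl fun m hm => ?_
      have hmn : m ≤ n := fun i =>
        Nat.lt_succ_iff.1 (mem_range.1 (Fintype.mem_piFinset.1 hm i))
      rw [← firstStep_recurrence (fun i => x i 0) (t 0) hmn hs]
      simp only [sub_mul, sum_mul, mul_assoc]
    _ = _ := by simp

/-- Proposition 4 of the paper: for `p ≥ 2`,
`(n_1+⋯+n_r+t_1)·c^{t_1,…,t_{p−1}}_{x_1;⋯;x_r}(n)
 − Σ_k x_{k1} n_k · c^{t_1,…,t_{p−1}}_{x_1;⋯;x_r}(n − e_k)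
 = c^{t_2,…,t_{p−1}}_{⁻x_1;⋯;⁻x_r}(n)`,
where `⁻x = (x_2,…,x_p)` (the `k`-th term of the sum vanishing when
`n_k = 0` because of the factor `n_k`). -/
theorem stmt8 (r p : ℕ) (hr : 0 < r) (hp : 2 ≤ p)
    (x : Fin r → Fin p → ℂ) (t : Fin (p - 1) → ℂ)
    (ht : ∀ (j : Fin (p - 1)) (m : ℕ), t j ≠ -(m : ℂ))
    (n : Fin r → ℕ) :
    ((∑ k : Fin r, (n k : ℂ)) + t ⟨0, by omega⟩) * nestedC r p x t n
      - ∑ k : Fin r, x k ⟨0, by omega⟩ * (n k : ℂ) *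
          nestedC r p x t (Function.update n k (n k - 1))
    = nestedC r (p - 1) (fun i j => x i ⟨j.1 + 1, by omega⟩)
        (fun j => t ⟨j.1 + 1, by omega⟩) n := by
  obtain ⟨q, rfl⟩ : ∃ q, p = q + 2 := ⟨p - 2, by omega⟩
  exact nestedC_recurrence x t (ht ⟨0, by omega⟩) n
end

section
/- Fix positive integers r and p. Let x_1,…,x_r ∈ ℂ^p and t_1,…,t_{p−1} ∈ ℂ ∖ {0,−1,−2,…}. Then for all n_1,…,n_r ∈ ℕ: Σ_{k_1=0}^{n_1} ⋯ Σ_{k_r=0}^{n_r} (−1)^{k_1+⋯+k_r} C(n_1,k_1) ⋯ C(n_r,k_r) c^{t_1,…,t_{p−1}}_{x_1;⋯;x_r}(k_1,…,k_r) = c^{t_1,…,t_{p−1}}_{1−x_1;⋯;1−x_r}(n_1,…,n_r), where 1−x = (1−x_1,…,1−x_p) for x = (x_1,…,x_p) ∈ ℂ^p and C(n,k) is the ordinary binomial coefficient. Equivalently, ∇ c^{t_1,…,t_{p−1}}_{x_1;⋯;x_r} = c^{t_1,…,t_{p−1}}_{1−x_1;⋯;1−x_r}. -/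
open Finset

/-- The alternating sum computing the beta integral `∫₀¹ s ^ (z - 1) (1 - s) ^ k ds` when it
converges. -/
theorem sum_alternating_choose_mul_inv (k : ℕ) (z : ℂ) (hz : ∀ m : ℕ, z + m ≠ 0) :
    ∑ i ∈ range (k + 1), (-1 : ℂ) ^ i * (k.choose i : ℂ) * (z + i)⁻¹ =
      (k.factorial : ℂ) / ∏ i ∈ range (k + 1), (z + i) := by
  induction k generalizing z with
  | zero => simp
  | succ k ih =>
    have hz1 : ∀ m : ℕ, z + 1 + m ≠ 0 := fun m => by
      have := hz (m + 1)
      push_cast at this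
      rwa [add_assoc, add_comm (1 : ℂ)]
    have hsplit : ∑ i ∈ range (k + 1 + 1), (-1 : ℂ) ^ i * ((k + 1).choose i : ℂ) * (z + i)⁻¹ =
        ∑ i ∈ range (k + 1), (-1 : ℂ) ^ i * (k.choose i : ℂ) * (z + i)⁻¹ -
        ∑ i ∈ range (k + 1), (-1 : ℂ) ^ i * (k.choose i : ℂ) * (z + 1 + i)⁻¹ := by
      have hext : ∑ i ∈ range (k + 1), (-1 : ℂ) ^ i * (k.choose i : ℂ) * (z + i)⁻¹ =
          ∑ i ∈ range (k + 1 + 1), (-1 : ℂ) ^ i * (k.choose i : ℂ) * (z + i)⁻¹ := by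
        rw [sum_range_succ _ (k + 1)]
        simp
      rw [hext, sum_range_succ', sum_range_succ' _ (k + 1), add_sub_right_comm,
        ← sum_sub_distrib]
      congr 1
      · refine sum_congr rfl fun i _ => ?_
        rw [Nat.choose_succ_succ]
        push_cast
        rw [show z + 1 + (i : ℂ) = z + (i + 1) by ring]
        ring
      · simp
    rw [hsplit, ih z hz, ih (z + 1) hz1]
    have hP : ∏ i ∈ range k, (z + 1 + i) ≠ 0 := prod_ne_zero_iff.mpr fun i _ => hz1 i
    have hleft : ∏ i ∈ range (k + 1), (z + i) = z * ∏ i ∈ range k, (z + 1 + i) := by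
      rw [prod_range_succ', mul_comm]
      congr 1
      · simp
      · refine prod_congr rfl fun i _ => ?_
        push_cast
        ring
    have hlast : ∏ i ∈ range (k + 1 + 1), (z + i) =
        (z * ∏ i ∈ range k, (z + 1 + i)) * (z + 1 + k) := by
      rw [prod_range_succ, hleft]
      push_cast
      ring
    rw [hlast, hleft, prod_range_succ]
    have h0 : z ≠ 0 := by simpa using hz 0
    have hk := hz1 k
    rw [Nat.factorial_succ]
    push_cast
    field_simp
    ring

theorem gbinom_add_mul_eq (k : ℕ) (z : ℂ) :
    gbinom (z + k - 1) k * (z + k) = (∏ i ∈ range (k + 1), (z + i)) / (k.factorial : ℂ) := by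
  rw [gbinom, prod_range_succ, ← prod_range_reflect, div_mul_eq_mul_div]
  congr 2
  refine prod_congr rfl fun i hi => ?_
  have hi' := mem_range.mp hi
  rw [Nat.cast_sub (by omega), Nat.cast_sub (by omega)]
  push_cast
  ring

/-- The linear functional sending `∏ X_l ^ m_l` to `∏ 1 / (m_l + t_l)`; when it converges, this is
`f ↦ ∫ f(s) ∏ s_l ^ (t_l - 1) ds` over the unit cube. -/
noncomputable def cubeFunctional {q : ℕ} (t : Fin q → ℂ) : MvPolynomial (Fin q) ℂ →ₗ[ℂ] ℂ :=
  (MvPolynomial.basisMonomials (Fin q) ℂ).constr ℂ fun m => ∏ l, ((m l : ℂ) + t l)⁻¹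

theorem cubeFunctional_prod_X_pow {q : ℕ} (t : Fin q → ℂ) (m : Fin q → ℕ) :
    cubeFunctional t (∏ l, MvPolynomial.X l ^ m l) = ∏ l, ((m l : ℂ) + t l)⁻¹ := by
  have h : ∏ l, (MvPolynomial.X l : MvPolynomial (Fin q) ℂ) ^ m l =
      MvPolynomial.basisMonomials (Fin q) ℂ (Finsupp.equivFunOnFinite.symm m) := by
    simp only [MvPolynomial.coe_basisMonomials]
    rw [MvPolynomial.monomial_eq, map_one, one_mul,
      Finsupp.prod_fintype _ _ (by simp)]
    simp
  rw [h, cubeFunctional, Module.Basis.constr_basis]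
  simp

theorem one_sub_pow_eq_sum {R : Type*} [CommRing R] [Algebra ℂ R] (y : R) (n : ℕ) :
    (1 - y) ^ n = ∑ k ∈ range (n + 1), ((-1 : ℂ) ^ k * (n.choose k : ℂ)) • y ^ k := by
  rw [sub_eq_neg_add, add_pow]
  refine sum_congr rfl fun k _ => ?_
  rw [Algebra.smul_def, neg_pow]
  simp only [map_mul, map_pow, map_neg, map_one, map_natCast, one_pow]
  ring

theorem cubeFunctional_prod_one_sub_pow_mul_pow {q : ℕ} (t : Fin q → ℂ)
    (ht : ∀ (l : Fin q) (m : ℕ), t l ≠ -(m : ℂ)) (k m : Fin q → ℕ) :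
    cubeFunctional t (∏ l, ((1 - MvPolynomial.X l) ^ k l * MvPolynomial.X l ^ m l)) =
      ∏ l, (gbinom ((m l : ℂ) + k l + t l - 1) (k l) * ((m l : ℂ) + k l + t l))⁻¹ := by
  simp_rw [one_sub_pow_eq_sum, sum_mul, smul_mul_assoc, ← pow_add]
  rw [prod_univ_sum, map_sum]
  simp_rw [prod_smul, map_smul, cubeFunctional_prod_X_pow, smul_eq_mul, ← prod_mul_distrib]
  rw [← prod_univ_sum (fun l => range (k l + 1)) (fun l i =>
    (-1 : ℂ) ^ i * ((k l).choose i : ℂ) * (((i + m l : ℕ) : ℂ) + t l)⁻¹)]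
  refine prod_congr rfl fun l _ => ?_
  have hz : ∀ i : ℕ, ((m l : ℂ) + t l) + i ≠ 0 := fun i h => ht l (m l + i) (by
    push_cast
    linear_combination h)
  have hsum := sum_alternating_choose_mul_inv (k l) _ hz
  have hbinom := gbinom_add_mul_eq (k l) ((m l : ℂ) + t l)
  rw [show (m l : ℂ) + k l + t l = m l + t l + k l by ring, hbinom, inv_div, ← hsum]
  refine sum_congr rfl fun i _ => ?_
  push_cast
  congr 2
  ring

/-- The stick-breaking weights `(1 - s_j) ∏_{l < j} s_l`, closed off by the weight `∏ s_l`. -/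
def stickWeight {R : Type*} [CommRing R] {q : ℕ} (s : Fin q → R) (j : Fin (q + 1)) : R :=
  (Fin.snoc (fun l => 1 - s l) 1 : Fin (q + 1) → R) j *
    ∏ l : Fin q, if l.castSucc < j then s l else 1

theorem sum_stickWeight {R : Type*} [CommRing R] {q : ℕ} (s : Fin q → R) :
    ∑ j, stickWeight s j = 1 := by
  have h := prod_one_sub_ordered univ (fun l => 1 - s l)
  simp only [sub_sub_cancel] at h
  rw [Fin.sum_univ_castSucc]
  simp only [stickWeight, Fin.snoc_castSucc, Fin.snoc_last, Fin.castSucc_lt_last, if_true,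
    one_mul, Fin.castSucc_lt_castSucc_iff]
  rw [h]
  simp [prod_filter]

theorem prod_stickWeight_pow {R : Type*} [CommRing R] {q : ℕ} (s : Fin q → R)
    (N : Fin (q + 1) → ℕ) :
    ∏ j, stickWeight s j ^ N j =
      ∏ l : Fin q, ((1 - s l) ^ N l.castSucc *
        s l ^ ∑ j, if l.castSucc < j then N j else 0) := by
  simp only [stickWeight, mul_pow, prod_mul_distrib, ← prod_pow]
  congr 1
  · rw [Fin.prod_univ_castSucc]
    simp
  · rw [prod_comm]
    refine prod_congr rfl fun l _ => ?_
    rw [← prod_pow_eq_pow_sum]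
    refine prod_congr rfl fun j _ => ?_
    split_ifs <;> simp

theorem tailSum_castSucc {q : ℕ} (ν : Fin (q + 1) → ℕ) (l : Fin q) :
    tailSum ν l.castSucc = (∑ j, if l.castSucc < j then ν j else 0) + ν l.castSucc := by
  have h : ν l.castSucc = ∑ j, if l.castSucc = j then ν j else 0 := by simp
  rw [tailSum, h, ← sum_add_distrib]
  refine sum_congr rfl fun j _ => ?_
  rcases lt_trichotomy l.castSucc j with h | h | h
  · simp [h.le, h, h.ne]
  · simp [h]
  · simp [h.not_ge, h.not_gt, h.ne']

theorem nestedC_eq_cubeFunctional (r q : ℕ) (x : Fin r → Fin (q + 1) → ℂ) (t : Fin q → ℂ)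
    (ht : ∀ (l : Fin q) (m : ℕ), t l ≠ -(m : ℂ)) (n : Fin r → ℕ) :
    nestedC r (q + 1) x t n =
      cubeFunctional t (∏ i, (∑ j, x i j • stickWeight MvPolynomial.X j) ^ n i) := by
  simp_rw [sum_pow_eq_sum_piAntidiag, piAntidiag_univ_fin_eq_antidiagonalTuple]
  rw [prod_univ_sum, map_sum, nestedC]
  refine sum_congr rfl fun ν _ => ?_
  have hterm : ∏ i, ((Nat.multinomial univ (ν i) : MvPolynomial (Fin q) ℂ) *
        ∏ j, (x i j • stickWeight MvPolynomial.X j) ^ ν i j) =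
      (∏ i, ((Nat.multinomial univ (ν i) : ℂ) * ∏ j, x i j ^ ν i j)) •
        ∏ j, stickWeight (MvPolynomial.X : Fin q → MvPolynomial (Fin q) ℂ) j ^ ∑ i, ν i j := by
    simp_rw [← prod_pow_eq_pow_sum]
    rw [prod_comm, ← prod_smul]
    refine prod_congr rfl fun i _ => ?_
    simp_rw [smul_pow, Algebra.smul_def, prod_mul_distrib, map_mul, map_prod, map_natCast,
      mul_assoc]
  rw [hterm, map_smul, prod_stickWeight_pow, cubeFunctional_prod_one_sub_pow_mul_pow t ht,
    smul_eq_mul, div_eq_mul_inv, prod_inv_distrib]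
  congr 2
  refine prod_congr rfl fun (l : Fin q) _ => ?_
  have htail : ((∑ i, (tailSum (ν i) l.castSucc : ℕ) : ℕ) : ℂ) =
      ((∑ j, if l.castSucc < j then ∑ i, ν i j else 0 : ℕ) : ℂ) +
        ((∑ i, ν i l.castSucc : ℕ) : ℂ) := by
    rw [← Nat.cast_add]
    congr 1
    simp_rw [tailSum_castSucc, sum_add_distrib]
    rw [sum_comm]
    congr 1
    refine sum_congr rfl fun j _ => ?_
    split_ifs <;> simp
  rw [← htail]
  push_cast
  rfl

/-- the duality, main result of the paper:
`Σ_{k_1=0}^{n_1}⋯Σ_{k_r=0}^{n_r} (−1)^{k_1+⋯+k_r} C(n_1,k_1)⋯C(n_r,k_r)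
  c^{t_1,…,t_{p−1}}_{x_1;⋯;x_r}(k)
 = c^{t_1,…,t_{p−1}}_{1−x_1;⋯;1−x_r}(n)`, i.e. `∇ c_{x} = c_{1−x}`. -/
theorem stmt10 (r p : ℕ) (hr : 0 < r) (hp : 0 < p)
    (x : Fin r → Fin p → ℂ) (t : Fin (p - 1) → ℂ)
    (ht : ∀ (j : Fin (p - 1)) (m : ℕ), t j ≠ -(m : ℂ))
    (n : Fin r → ℕ) :
    ∑ k ∈ Fintype.piFinset (fun i : Fin r => Finset.range (n i + 1)),
      (-1 : ℂ) ^ (∑ i : Fin r, k i) * (∏ i : Fin r, (Nat.choose (n i) (k i) : ℂ)) *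
        nestedC r p x t k
    = nestedC r p (fun i j => 1 - x i j) t n := by
  obtain ⟨q, rfl⟩ : ∃ q, p = q + 1 := ⟨p - 1, by omega⟩
  change Fin q → ℂ at t
  change ∀ (j : Fin q) (m : ℕ), t j ≠ -(m : ℂ) at ht
  have hcompl : ∀ i, ∑ j, (1 - x i j) • stickWeight (MvPolynomial.X : Fin q → MvPolynomial (Fin q) ℂ) j =
      1 - ∑ j, x i j • stickWeight MvPolynomial.X j := fun i => by
    simp_rw [sub_smul, one_smul, sum_sub_distrib, sum_stickWeight]
  rw [nestedC_eq_cubeFunctional r q _ t ht]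
  simp_rw [nestedC_eq_cubeFunctional r q x t ht, hcompl, one_sub_pow_eq_sum]
  rw [prod_univ_sum, map_sum]
  refine sum_congr rfl fun k _ => ?_
  rw [prod_smul, map_smul, smul_eq_mul, prod_mul_distrib, prod_pow_eq_pow_sum]
end

section
/- Fix positive integers r and p. Let x_1,…,x_r ∈ ℂ^p, let c ∈ ℂ, and let i_1,…,i_q be distinct integers with 1 ≤ i_1,…,i_q ≤ r such that x_{i_1}+⋯+x_{i_q} = (c,c,…,c) ∈ ℂ^p (componentwise sum). Then for any t_1,…,t_{p−1} ∈ ℂ ∖ {0,−1,−2,…} and all n_1,…,n_r ∈ ℕ: Σ_{m=1}^q c^{t_1,…,t_{p−1}}_{x_1;⋯;x_r}(n_1,…,n_{i_m}+1,…,n_r) = c · c^{t_1,…,t_{p−1}}_{x_1;⋯;x_r}(n_1,…,n_r). (Equivalently, (∂_{X_{i_1}}+⋯+∂_{X_{i_q}} − c) f^{t_1,…,t_{p−1}}_{x_1;⋯;x_r} = 0 where f^{t_1,…,t_{p−1}}_{x_1;⋯;x_r} is the exponential generating function of the nested sums.) -/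
open Finset

/-- The product `∏_{i=0}^{v} (a + i) / v!`, the reciprocal of the Beta value `B(v + 1, a)`. -/
noncomputable def betaRecip (v : ℕ) (a : ℂ) : ℂ :=
  (∏ i ∈ Finset.range (v + 1), (a + (i : ℂ))) / (Nat.factorial v : ℂ)

theorem gbinom_mul_eq_betaRecip (v : ℕ) (a : ℂ) :
    gbinom (v + a - 1) v * (v + a) = betaRecip v a := by
  unfold gbinom betaRecip
  rw [Finset.prod_range_succ, ← Finset.prod_range_reflect]
  have h : ∀ i ∈ Finset.range v, (v + a - 1 - ((v - 1 - i : ℕ) : ℂ)) = a + i := by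
    intro i hi
    have hi' := Finset.mem_range.mp hi
    have hcast : ((v - 1 - i : ℕ) : ℂ) + 1 + i = v := by
      have : v - 1 - i + 1 + i = v := by omega
      exact_mod_cast this
    linear_combination -hcast
  rw [Finset.prod_congr rfl h]
  ring

theorem betaRecip_inv_add (v : ℕ) (a : ℂ) (ha : ∀ m : ℕ, a + m ≠ 0) :
    (betaRecip (v + 1) a)⁻¹ + (betaRecip v (a + 1))⁻¹ = (betaRecip v a)⁻¹ := by
  have hP : ∏ i ∈ Finset.range v, (a + 1 + (i : ℂ)) ≠ 0 := by
    refine Finset.prod_ne_zero_iff.mpr fun i _ => ?_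
    have := ha (i + 1)
    push_cast at this
    rwa [add_assoc, add_comm (1 : ℂ)]
  have hQ : ∀ k : ℕ, ∏ i ∈ Finset.range (k + 1), (a + (i : ℂ)) =
      (∏ i ∈ Finset.range k, (a + 1 + (i : ℂ))) * a := by
    intro k
    rw [Finset.prod_range_succ']
    congr 1
    · refine Finset.prod_congr rfl fun i _ => ?_
      push_cast
      ring
    · simp
  have h0 : a ≠ 0 := by simpa using ha 0
  have h1 : a + 1 + v ≠ 0 := by
    have := ha (v + 1)
    push_cast at this
    rwa [add_assoc, add_comm (1 : ℂ)]
  have hf : (Nat.factorial v : ℂ) ≠ 0 := by exact_mod_cast Nat.factorial_ne_zero v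
  have hv : (v : ℂ) + 1 ≠ 0 := by exact_mod_cast Nat.succ_ne_zero v
  unfold betaRecip
  rw [hQ, hQ, Finset.prod_range_succ, Nat.factorial_succ]
  push_cast
  field_simp
  ring

theorem tailSum_sum {r p : ℕ} (ν : Fin r → Fin p → ℕ) (j : Fin p) :
    tailSum (fun l => ∑ i, ν i l) j = ∑ i, tailSum (ν i) j := by
  unfold tailSum
  rw [Finset.sum_comm]
  refine Finset.sum_congr rfl fun l _ => ?_
  split_ifs <;> simp

theorem tailSum_zero_s12 {s : ℕ} (V : Fin (s + 1) → ℕ) : tailSum V 0 = ∑ l, V l := by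
  simp [tailSum]

theorem tailSum_succ {s : ℕ} (V : Fin (s + 1) → ℕ) (j : Fin s) :
    tailSum V j.succ = tailSum (Fin.tail V) j := by
  simp [tailSum, Fin.sum_univ_succ, Fin.tail]

/-- The Dirichlet-type moment attached to the total increments `V`: the reciprocal of the
denominator in `nestedC`. -/
noncomputable def chainWeight {s : ℕ} (t : Fin s → ℂ) (V : Fin (s + 1) → ℕ) : ℂ :=
  (∏ j : Fin s, gbinom ((tailSum V j.castSucc : ℂ) + t j - 1) (V j.castSucc) *
    ((tailSum V j.castSucc : ℂ) + t j))⁻¹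

theorem chainWeight_succ {s : ℕ} (t : Fin (s + 1) → ℂ) (V : Fin (s + 2) → ℕ) :
    chainWeight t V =
      (betaRecip (V 0) (((∑ l, Fin.tail V l : ℕ) : ℂ) + t 0))⁻¹ *
        chainWeight (Fin.tail t) (Fin.tail V) := by
  unfold chainWeight
  rw [Fin.prod_univ_succ, mul_inv, ← gbinom_mul_eq_betaRecip]
  congr 2
  · rw [Fin.castSucc_zero, tailSum_zero_s12, Fin.sum_univ_succ]
    simp only [Fin.tail, Nat.cast_add, Nat.cast_sum, add_assoc]
  · refine Finset.prod_congr rfl fun j _ => ?_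
    rw [← Fin.succ_castSucc, tailSum_succ]
    rfl

theorem sum_chainWeight_add_single {s : ℕ} (t : Fin s → ℂ)
    (ht : ∀ (j : Fin s) (m : ℕ), t j ≠ -(m : ℂ)) (V : Fin (s + 1) → ℕ) :
    ∑ k, chainWeight t (V + Pi.single k 1) = chainWeight t V := by
  induction s with
  | zero => simp [chainWeight]
  | succ s ih =>
    have htail0 : Fin.tail (V + Pi.single 0 1) = Fin.tail V := by
      funext l
      simp [Fin.tail]
    have htail : ∀ k : Fin (s + 1),
        Fin.tail (V + Pi.single k.succ 1) = Fin.tail V + Pi.single k 1 := by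
      intro k
      funext l
      simp [Fin.tail, Pi.single_apply]
    have hsum : ∀ k : Fin (s + 1), ∑ l, (Fin.tail V + Pi.single k 1 : Fin (s + 1) → ℕ) l
        = ∑ l, Fin.tail V l + 1 := by
      intro k
      simp [Finset.sum_add_distrib]
    have hzero : ∀ k : Fin (s + 1), (V + Pi.single k.succ 1 : Fin (s + 2) → ℕ) 0 = V 0 := by
      intro k
      simp
    have hone : (V + Pi.single 0 1 : Fin (s + 2) → ℕ) 0 = V 0 + 1 := by simp
    rw [Fin.sum_univ_succ]
    simp only [chainWeight_succ, htail0, htail, hsum, hzero, hone]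
    rw [← Finset.mul_sum, ih (Fin.tail t) (fun j m => ht j.succ m), ← add_mul]
    congr 1
    rw [← betaRecip_inv_add (V 0) (((∑ l, Fin.tail V l : ℕ) : ℂ) + t 0)]
    · rw [Nat.cast_succ, add_right_comm _ (1 : ℂ) (t 0)]
    · intro m h
      refine ht 0 (∑ l, Fin.tail V l + m) ?_
      push_cast at h ⊢
      linear_combination h

/-- The linear functional on polynomials sending the monomial `X^V` to `chainWeight t V`. -/
noncomputable def chainFunctional {s : ℕ} (t : Fin s → ℂ) :
    MvPolynomial (Fin (s + 1)) ℂ →ₗ[ℂ] ℂ :=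
  (MvPolynomial.basisMonomials (Fin (s + 1)) ℂ).constr ℂ fun V => chainWeight t V

theorem chainFunctional_monomial {s : ℕ} (t : Fin s → ℂ) (V : Fin (s + 1) →₀ ℕ) :
    chainFunctional t (MvPolynomial.monomial V 1) = chainWeight t V := by
  have h := (MvPolynomial.basisMonomials (Fin (s + 1)) ℂ).constr_basis ℂ
    (fun V => chainWeight t V) V
  rwa [MvPolynomial.coe_basisMonomials] at h

theorem chainFunctional_C_mul_prod {s : ℕ} (t : Fin s → ℂ) (a : ℂ) (V : Fin (s + 1) → ℕ) :
    chainFunctional t (MvPolynomial.C a * ∏ j, MvPolynomial.X j ^ V j) =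
      a * chainWeight t V := by
  have h : (∏ j, MvPolynomial.X j ^ V j : MvPolynomial (Fin (s + 1)) ℂ) =
      MvPolynomial.monomial (Finsupp.equivFunOnFinite.symm V) 1 := by
    rw [MvPolynomial.monomial_eq, Finsupp.prod_fintype _ _ (fun _ => pow_zero _)]
    simp
  rw [← MvPolynomial.smul_eq_C_mul, map_smul, h, chainFunctional_monomial]
  simp

theorem chainFunctional_mul_sum_X {s : ℕ} (t : Fin s → ℂ)
    (ht : ∀ (j : Fin s) (m : ℕ), t j ≠ -(m : ℂ)) (P : MvPolynomial (Fin (s + 1)) ℂ) :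
    chainFunctional t (P * ∑ j, MvPolynomial.X j) = chainFunctional t P := by
  induction P using MvPolynomial.induction_on' with
  | monomial V a =>
    have ha : MvPolynomial.monomial V a = a • MvPolynomial.monomial V (1 : ℂ) := by
      simp [MvPolynomial.smul_monomial]
    rw [ha, smul_mul_assoc, map_smul, map_smul, Finset.mul_sum, map_sum,
      chainFunctional_monomial, ← sum_chainWeight_add_single t ht]
    congr 1
    refine Finset.sum_congr rfl fun k _ => ?_
    rw [MvPolynomial.X, MvPolynomial.monomial_mul, mul_one, chainFunctional_monomial,
      Finsupp.coe_add, Finsupp.single_eq_pi_single]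
  | add P Q hP hQ => rw [add_mul, map_add, map_add, hP, hQ]

theorem antidiagonalTuple_eq_piAntidiag (p n : ℕ) :
    Finset.Nat.antidiagonalTuple p n = Finset.piAntidiag Finset.univ n := by
  ext ν
  simp [Finset.Nat.mem_antidiagonalTuple]

theorem nestedC_eq_chainFunctional (r s : ℕ) (x : Fin r → Fin (s + 1) → ℂ) (t : Fin s → ℂ)
    (n : Fin r → ℕ) :
    nestedC r (s + 1) x t n = chainFunctional t
      (∏ i, (∑ j, MvPolynomial.C (x i j) * MvPolynomial.X j) ^ n i) := by
  simp only [Finset.sum_pow_eq_sum_piAntidiag, ← antidiagonalTuple_eq_piAntidiag]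
  rw [Finset.prod_univ_sum, map_sum]
  unfold nestedC
  refine Finset.sum_congr rfl fun ν _ => ?_
  have h : (∏ i, ((Nat.multinomial Finset.univ (ν i) : MvPolynomial (Fin (s + 1)) ℂ) *
        ∏ j, (MvPolynomial.C (x i j) * MvPolynomial.X j) ^ ν i j)) =
      MvPolynomial.C (∏ i, ((Nat.multinomial Finset.univ (ν i) : ℂ) * ∏ j, x i j ^ ν i j)) *
        ∏ j, MvPolynomial.X j ^ ∑ i, ν i j := by
    simp only [mul_pow, Finset.prod_mul_distrib, map_mul, map_prod, map_pow, map_natCast,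
      ← Finset.prod_pow_eq_pow_sum]
    rw [Finset.prod_comm (f := fun (j : Fin (s + 1)) (i : Fin r) =>
      (MvPolynomial.X j : MvPolynomial (Fin (s + 1)) ℂ) ^ ν i j), mul_assoc]
  rw [h, chainFunctional_C_mul_prod, chainWeight, div_eq_mul_inv]
  simp only [tailSum_sum, Nat.cast_sum]
  rfl

/-- Theorem 2 of the paper: if `i_1,…,i_q` are distinct indices with
`x_{i_1}+⋯+x_{i_q} = (c,…,c)` componentwise, then
`Σ_m c^{t_1,…,t_{p−1}}_{x_1;⋯;x_r}(n + e_{i_m}) = c · c^{t_1,…,t_{p−1}}_{x_1;⋯;x_r}(n)`,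
i.e. `(∂_{X_{i_1}}+⋯+∂_{X_{i_q}} − c) f^{t}_{x} = 0`. -/
theorem stmt12 (r p q : ℕ) (hr : 0 < r) (hp : 0 < p)
    (x : Fin r → Fin p → ℂ) (c : ℂ)
    (idx : Fin q → Fin r) (hinj : Function.Injective idx)
    (hx : ∀ j : Fin p, ∑ m : Fin q, x (idx m) j = c)
    (t : Fin (p - 1) → ℂ)
    (ht : ∀ (j : Fin (p - 1)) (m : ℕ), t j ≠ -(m : ℂ))
    (n : Fin r → ℕ) :
    ∑ m : Fin q,
        nestedC r p x t (Function.update n (idx m) (n (idx m) + 1))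
      = c * nestedC r p x t n := by
  obtain ⟨s, rfl⟩ : ∃ s, p = s + 1 := ⟨p - 1, by omega⟩
  let ℓ : Fin r → MvPolynomial (Fin (s + 1)) ℂ := fun i =>
    ∑ j, MvPolynomial.C (x i j) * MvPolynomial.X j
  have hstep : ∀ k : Fin r, ∏ i, ℓ i ^ Function.update n k (n k + 1) i =
      (∏ i, ℓ i ^ n i) * ℓ k := by
    intro k
    rw [← Finset.mul_prod_erase _ _ (Finset.mem_univ k),
      ← Finset.mul_prod_erase _ (fun i => ℓ i ^ n i) (Finset.mem_univ k),
      Function.update_self, pow_succ]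
    have : ∀ i ∈ Finset.univ.erase k, ℓ i ^ Function.update n k (n k + 1) i = ℓ i ^ n i := by
      intro i hi
      rw [Function.update_of_ne (Finset.ne_of_mem_erase hi)]
    rw [Finset.prod_congr rfl this]
    ring
  have hsum : ∑ m, ℓ (idx m) = MvPolynomial.C c * ∑ j, MvPolynomial.X j := by
    simp only [ℓ]
    rw [Finset.sum_comm, Finset.mul_sum]
    refine Finset.sum_congr rfl fun j _ => ?_
    rw [← Finset.sum_mul, ← map_sum, hx]
  have hnested : ∀ n', nestedC r (s + 1) x t n' = chainFunctional t (∏ i, ℓ i ^ n' i) :=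
    nestedC_eq_chainFunctional r s x t
  simp only [hnested, hstep]
  rw [← map_sum, ← Finset.mul_sum, hsum, mul_left_comm, ← MvPolynomial.smul_eq_C_mul, map_smul,
    smul_eq_mul]
  exact congrArg (c * ·) (chainFunctional_mul_sum_X (s := s) t ht _)
end
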